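/- B = A[X;*]^fl is commutative if and only if A is commutative and the involution * of A is trivial (a* = a for all a ∈ A). -/

import Mathlib

/-- `tau n a b = ab` if `n` is even and `ba` if `n` is odd. -/
def tau {A : Type*} [NonAssocRing A] (n : ℕ) (a b : A) : A :=
  if Even n then a * b else b * a

/-- The `m`-fold iterate `*^m` of the involution `*`. -/
def starIter {A : Type*} [NonAssocRing A] [StarRing A] : ℕ → A → A
  | 0, a => a
  | m+1, a => star (starIter m a)

/-- The multiplication of the flipped non-associative skew polynomial ring `B = A[X;*]^fl`:
the biadditive extension of `(aX^m)(bX^n) = τ_n(a, *^m(b)) X^{m+n}`. Polynomials are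
represented as finitely supported functions `ℕ →₀ A`. -/
noncomputable def fmul {A : Type*} [NonAssocRing A] [StarRing A] (p q : ℕ →₀ A) : ℕ →₀ A :=
  p.sum fun m a => q.sum fun n b => Finsupp.single (m+n) (tau n a (starIter m b))

/-- The map `α : B → B`, `α(Σ_i a_i X^i) = Σ_i (−1)^i *^{i+1}(a_i) X^i`. -/
noncomputable def alphaMap {A : Type*} [NonAssocRing A] [StarRing A] (p : ℕ →₀ A) : ℕ →₀ A :=
  p.sum fun i a => Finsupp.single i ((-1 : ℤ) ^ i • starIter (i+1) a)

/-- The map `β : B → B`, `β(Σ_i a_i X^i) = Σ_i *^{i+1}(a_i) X^i`. -/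
noncomputable def betaMap {A : Type*} [NonAssocRing A] [StarRing A] (p : ℕ →₀ A) : ℕ →₀ A :=
  p.sum fun i a => Finsupp.single i (starIter (i+1) a)

/-- Every iterate of the involution fixes zero. -/
theorem starIter_zero_right {A : Type*} [NonAssocRing A] [StarRing A] (m : ℕ) :
    starIter m (0 : A) = 0 := by
  induction m with
  | zero => rfl
  | succ m ih => simp [starIter, ih]

/-- The product of two monomials. -/
theorem fmul_single_single {A : Type*} [NonAssocRing A] [StarRing A] (m n : ℕ) (a b : A) :
    fmul (Finsupp.single m a) (Finsupp.single n b) =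
      Finsupp.single (m + n) (tau n a (starIter m b)) := by
  unfold fmul
  rw [Finsupp.sum_single_index, Finsupp.sum_single_index]
  · simp [tau, starIter_zero_right]
  · simp [tau, Finsupp.sum]

/-- If the involution is trivial, so are all its iterates. -/
theorem starIter_of_star_eq {A : Type*} [NonAssocRing A] [StarRing A]
    (h : ∀ a : A, star a = a) (m : ℕ) (a : A) : starIter m a = a := by
  induction m with
  | zero => rfl
  | succ m ih => simp [starIter, ih, h]

/-- If `A` is commutative, then `tau` is the multiplication of `A`. -/
theorem tau_of_mul_comm {A : Type*} [NonAssocRing A]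
    (h : ∀ a b : A, a * b = b * a) (n : ℕ) (a b : A) : tau n a b = a * b := by
  simp [tau, h b a]

/-- `B = A[X;*]^fl` is commutative if and only if `A` is commutative and the
involution `*` of `A` is trivial. -/
theorem flipped_skew_polynomial_ring_commutative_iff
    {A : Type*} [NonAssocRing A] [StarRing A] :
    (∀ p q : ℕ →₀ A, fmul p q = fmul q p) ↔
      ((∀ a b : A, a * b = b * a) ∧ (∀ a : A, star a = a)) := by
  constructor
  · intro h
    refine ⟨fun a b => ?_, fun a => ?_⟩
    · have hab := h (Finsupp.single 0 a) (Finsupp.single 0 b)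
      rw [fmul_single_single, fmul_single_single] at hab
      simpa [tau, starIter] using Finsupp.single_injective 0 hab
    · have ha := h (Finsupp.single 1 1) (Finsupp.single 0 a)
      rw [fmul_single_single, fmul_single_single] at ha
      simpa [tau, starIter] using Finsupp.single_injective 1 ha
  · rintro ⟨hc, hs⟩ p q
    simp only [fmul, starIter_of_star_eq hs, tau_of_mul_comm hc]
    rw [Finsupp.sum_comm]
    simp only [hc, add_comm]
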